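/- There exist constants $R_0 > 0$ and $C_0 > 0$ (independent of the initial value) such that the following holds for each sign $\varepsilon \in \{-1,+1\}$: if $\rho_0 \ge R_0$ and $\rho : [0,\infty) \to \mathbb{R}$ is a differentiable function with $\rho(0) = \rho_0$, $\rho(t) \ge \rho_0$ for all $t \ge 0$, and $\rho'(t) = \left(2\,\frac{\cosh \rho(t)}{\sinh \rho(t)} + 2\varepsilon\, e^{-2\rho(t)}\right)^{-1}$ for all $t \ge 0$, then $\left|\rho(t) - \rho_0 - \tfrac{t}{2}\right| \le C_0$ for all $t \ge 0$. -/

import Mathlib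

open Real

lemma cosh_div_sinh_eq {r : ℝ} (hr : 0 < r) :
    Real.cosh r / Real.sinh r = (1 + Real.exp (-2 * r)) / (1 - Real.exp (-2 * r)) := by
  have hs : Real.sinh r ≠ 0 := (Real.sinh_pos_iff.2 hr).ne'
  have hx : Real.exp (-2 * r) < 1 := Real.exp_lt_one_iff.2 (by linarith)
  have h1 : Real.exp r * Real.exp (-2 * r) = Real.exp (-r) := by
    rw [← Real.exp_add]; ring_nf
  rw [div_eq_div_iff hs (by linarith), Real.cosh_eq, Real.sinh_eq, ← h1]
  ring

/-- The denominator of the radial speed lies between `2` and `2 + 10 e^{-2r}`. -/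
lemma two_coth_add_bounds {ε r : ℝ} (hε : ε = -1 ∨ ε = 1) (hr : 1 ≤ r) :
    2 ≤ 2 * (Real.cosh r / Real.sinh r) + 2 * ε * Real.exp (-2 * r) ∧
      2 * (Real.cosh r / Real.sinh r) + 2 * ε * Real.exp (-2 * r) ≤
        2 + 10 * Real.exp (-2 * r) := by
  rw [cosh_div_sinh_eq (by linarith)]
  have hx0 : 0 < Real.exp (-2 * r) := Real.exp_pos _
  have hx : Real.exp (-2 * r) ≤ 1 / 2 := by
    have h := Real.add_one_le_exp (2 * r)
    have h2 : Real.exp (-2 * r) * Real.exp (2 * r) = 1 := by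
      rw [← Real.exp_add]; simp
    nlinarith
  generalize Real.exp (-2 * r) = x at hx0 hx
  have hlo : 1 + 2 * x ≤ (1 + x) / (1 - x) - 2 * x ^ 2 / (1 - x) := by
    rw [← sub_div, le_div_iff₀ (by linarith)]; nlinarith
  have hlo' : 0 ≤ 2 * x ^ 2 / (1 - x) := div_nonneg (by positivity) (by linarith)
  have hhi : (1 + x) / (1 - x) ≤ 1 + 4 * x := by
    rw [div_le_iff₀ (by linarith)]; nlinarith
  rcases hε with rfl | rfl <;> constructor <;> linarith

theorem stmt4 :
    ∃ R₀ > (0 : ℝ), ∃ C₀ > (0 : ℝ),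
      ∀ ε : ℝ, (ε = -1 ∨ ε = 1) →
      ∀ ρ₀ : ℝ, R₀ ≤ ρ₀ →
      ∀ ρ : ℝ → ℝ, ρ 0 = ρ₀ →
        (∀ t : ℝ, 0 ≤ t → ρ₀ ≤ ρ t) →
        (∀ t : ℝ, 0 ≤ t →
          HasDerivAt ρ ((2 * (Real.cosh (ρ t) / Real.sinh (ρ t)) +
            2 * ε * Real.exp (-2 * ρ t))⁻¹) t) →
        ∀ t : ℝ, 0 ≤ t → |ρ t - ρ₀ - t / 2| ≤ C₀ := by
  refine ⟨1, one_pos, 3, by norm_num, ?_⟩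
  intro ε hε ρ₀ hρ₀ ρ h0 hge hd t ht
  have hF : ∀ s, 0 ≤ s → HasDerivAt (fun s => ρ s - s / 2) _ s := fun s hs =>
    (hd s hs).sub ((hasDerivAt_id s).div_const 2)
  have hG : ∀ s, 0 ≤ s →
      HasDerivAt (fun s => ρ s - s / 2 - 5 / 2 * Real.exp (-2 * ρ s)) _ s := fun s hs =>
    (hF s hs).sub ((((hd s hs).const_mul (-2)).exp).const_mul (5 / 2))
  have hanti : AntitoneOn (fun s => ρ s - s / 2) (Set.Ici 0) := by
    refine antitoneOn_of_deriv_nonpos (convex_Ici 0)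
      (fun s hs => (hF s hs).continuousAt.continuousWithinAt) ?_ ?_ <;>
      rw [interior_Ici] <;> intro s hs
    · exact (hF s (le_of_lt hs)).differentiableAt.differentiableWithinAt
    · rw [(hF s (le_of_lt hs)).deriv]
      have hb := (two_coth_add_bounds hε (hρ₀.trans (hge s (le_of_lt hs)))).1
      have := inv_anti₀ two_pos hb
      linarith
  have hmono : MonotoneOn (fun s => ρ s - s / 2 - 5 / 2 * Real.exp (-2 * ρ s)) (Set.Ici 0) := by
    refine monotoneOn_of_deriv_nonneg (convex_Ici 0)
      (fun s hs => (hG s hs).continuousAt.continuousWithinAt) ?_ ?_ <;>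
      rw [interior_Ici] <;> intro s hs
    · exact (hG s (le_of_lt hs)).differentiableAt.differentiableWithinAt
    · rw [(hG s (le_of_lt hs)).deriv]
      obtain ⟨hb, hb'⟩ := two_coth_add_bounds hε (hρ₀.trans (hge s (le_of_lt hs)))
      generalize 2 * (Real.cosh (ρ s) / Real.sinh (ρ s)) + 2 * ε * Real.exp (-2 * ρ s) = D at *
      have hD : 0 < D⁻¹ := inv_pos.2 (by linarith)
      have hDD : D * D⁻¹ = 1 := mul_inv_cancel₀ (by linarith)
      nlinarith
  have h1 := hanti Set.self_mem_Ici (Set.mem_Ici.2 ht) ht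
  have h2 := hmono Set.self_mem_Ici (Set.mem_Ici.2 ht) ht
  simp only [h0] at h1 h2
  have h3 : Real.exp (-2 * ρ₀) ≤ 1 := Real.exp_le_one_iff.2 (by linarith)
  have h4 := Real.exp_pos (-2 * ρ t)
  rw [abs_le]
  constructor <;> linarith
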